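/- Let h > 0 be a real number with P(h) = 0, and let K₂ > 0 be a constant such that 1 ≤ ∑_{ω ∈ L_n} c_ω^h ≤ K₂ for all n ≥ 1. Then there exists a Borel probability measure ξ on the product space {0,1}^ℕ such that for every word ω: if ω ∈ L then ξ([ω]) ≤ K₂·c_ω^h, and if ω ∉ L then ξ([ω]) = 0, where [ω] denotes the cylinder set of all sequences in {0,1}^ℕ whose initial segment is ω. -/

import Mathlib

open Filter

/-- The weight `c_ω` of a word `ω` over the alphabet `{0,1}` (here `false` is the
letter 0 and `true` is the letter 1): the product of `c0` over letters 0 and `c1`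
over letters 1. -/
noncomputable def wt (c0 c1 : ℝ) (w : List Bool) : ℝ :=
  (w.map fun b => if b then c1 else c0).prod

/-- All words of length `n` over the alphabet `{0,1}`. -/
def allWords : ℕ → Finset (List Bool)
  | 0 => {[]}
  | n + 1 => (allWords n).biUnion fun w => {false :: w, true :: w}

/-- Membership in the language of the S-gap shift: every maximal block of 0s lying
strictly between two 1s has length in `S`. -/
def InLang (S : Set ℕ) (w : List Bool) : Prop :=
  ∀ u v : List Bool, ∀ m : ℕ,
    w = u ++ [true] ++ List.replicate m false ++ [true] ++ v → m ∈ S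

/-- Membership in the core set `G`: words of the form `0^{s₁}1 0^{s₂}1 ⋯ 0^{s_k}1`
with `k ≥ 1` and every `s_i ∈ S`. -/
def InCore (S : Set ℕ) (w : List Bool) : Prop :=
  ∃ bs : List ℕ, bs ≠ [] ∧ (∀ s ∈ bs, s ∈ S) ∧
    w = (bs.map fun s => List.replicate s false ++ [true]).flatten

/-- `L_n`: the words of length `n` in the language of the S-gap shift. -/
noncomputable def langWords (S : Set ℕ) (n : ℕ) : Finset (List Bool) :=
  @Finset.filter _ (InLang S) (Classical.decPred _) (allWords n)

/-- `G_n`: the core words of length `n`. -/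
noncomputable def coreWords (S : Set ℕ) (n : ℕ) : Finset (List Bool) :=
  @Finset.filter _ (InCore S) (Classical.decPred _) (allWords n)

/-- The cylinder set of a finite word: all sequences whose initial segment is the word. -/
def cylinder (w : List Bool) : Set (ℕ → Bool) := {ω | ∀ i : Fin w.length, ω i = w.get i}

lemma mem_allWords {n : ℕ} {w : List Bool} : w ∈ allWords n ↔ w.length = n := by
  induction n generalizing w with
  | zero => simp [allWords]
  | succ n ih => cases w with
    | nil => simp [allWords]
    | cons b w => cases b <;> simp [allWords, ih]

lemma mem_langWords {S : Set ℕ} {n : ℕ} {w : List Bool} :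
    w ∈ langWords S n ↔ w.length = n ∧ InLang S w := by
  simp [langWords, mem_allWords]

lemma wt_append (c0 c1 : ℝ) (u v : List Bool) :
    wt c0 c1 (u ++ v) = wt c0 c1 u * wt c0 c1 v := by
  simp [wt]

lemma wt_pos {c0 c1 : ℝ} (hc0 : 0 < c0) (hc1 : 0 < c1) (w : List Bool) : 0 < wt c0 c1 w := by
  refine List.prod_pos fun x hx => ?_
  obtain ⟨b, -, rfl⟩ := List.mem_map.1 hx
  cases b <;> simpa

lemma wt_append_rpow {c0 c1 : ℝ} (hc0 : 0 < c0) (hc1 : 0 < c1) (h : ℝ) (u v : List Bool) :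
    wt c0 c1 (u ++ v) ^ h = wt c0 c1 u ^ h * wt c0 c1 v ^ h := by
  rw [wt_append, Real.mul_rpow (wt_pos hc0 hc1 u).le (wt_pos hc0 hc1 v).le]

lemma InLang.left {S : Set ℕ} {u v : List Bool} (h : InLang S (u ++ v)) : InLang S u := by
  rintro a b m rfl
  exact h a (b ++ v) m (by simp)

lemma InLang.right {S : Set ℕ} {u v : List Bool} (h : InLang S (u ++ v)) : InLang S v := by
  rintro a b m rfl
  exact h (u ++ a) b m (by simp)

/-- The words of `L_n` beginning with `w` have total weight at most that of `w` times the total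
weight of the words of `L_{n - |w|}`. -/
lemma sum_langWords_prefix_le {S : Set ℕ} {c0 c1 : ℝ} (hc0 : 0 < c0) (hc1 : 0 < c1) (h : ℝ)
    (n : ℕ) (w : List Bool) :
    ∑ ω ∈ langWords S n with w <+: ω, wt c0 c1 ω ^ h ≤
      wt c0 c1 w ^ h * ∑ v ∈ langWords S (n - w.length), wt c0 c1 v ^ h := by
  classical
  have hsub : {ω ∈ langWords S n | w <+: ω} ⊆
      (langWords S (n - w.length)).image (w ++ ·) := by
    intro ω hω
    obtain ⟨hω, v, rfl⟩ := Finset.mem_filter.1 hω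
    obtain ⟨hlen, hL⟩ := mem_langWords.1 hω
    rw [List.length_append] at hlen
    exact Finset.mem_image_of_mem _ (mem_langWords.2 ⟨by omega, hL.right⟩)
  calc ∑ ω ∈ langWords S n with w <+: ω, wt c0 c1 ω ^ h
      ≤ ∑ ω ∈ (langWords S (n - w.length)).image (w ++ ·), wt c0 c1 ω ^ h :=
        Finset.sum_le_sum_of_subset_of_nonneg hsub fun ω _ _ =>
          (Real.rpow_pos_of_pos (wt_pos hc0 hc1 ω) h).le
    _ = wt c0 c1 w ^ h * ∑ v ∈ langWords S (n - w.length), wt c0 c1 v ^ h := by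
        rw [Finset.sum_image fun a _ b _ hab => List.append_cancel_left hab, Finset.mul_sum]
        exact Finset.sum_congr rfl fun v _ => wt_append_rpow hc0 hc1 h w v

lemma sum_langWords_prefix_eq_zero {S : Set ℕ} {w : List Bool} (hw : ¬ InLang S w) (n : ℕ)
    (f : List Bool → ℝ) : ∑ ω ∈ langWords S n with w <+: ω, f ω = 0 := by
  refine Finset.sum_eq_zero fun ω hω => absurd ?_ hw
  obtain ⟨hω, v, rfl⟩ := Finset.mem_filter.1 hω
  exact (mem_langWords.1 hω).2.left

lemma isClopen_cylinder (w : List Bool) : IsClopen (cylinder w) := by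
  have : cylinder w = ⋂ i : Fin w.length, (fun ω : ℕ → Bool => ω i) ⁻¹' {w.get i} := by
    ext ω
    simp [cylinder]
  rw [this]
  exact isClopen_iInter_of_finite fun i => (isClopen_discrete _).preimage (continuous_apply _)

lemma prefix_of_getD_mem_cylinder {w ω : List Bool} (hlen : w.length ≤ ω.length)
    (hω : (fun i => ω.getD i false) ∈ cylinder w) : w <+: ω := by
  rw [List.prefix_iff_getElem]
  refine ⟨hlen, fun i hi => ?_⟩
  have := hω ⟨i, hi⟩
  simpa [List.getElem?_eq_getElem (hi.trans_le hlen)] using this.symm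

/-- Normalizing nonnegative weights on words of length `n` with total mass at least `1` gives a
probability measure whose value on a cylinder `[w]`, `|w| ≤ n`, is at most the total weight of the
words beginning with `w`. -/
lemma exists_probabilityMeasure_cylinder_le (A : Finset (List Bool)) (n : ℕ)
    (hA : ∀ ω ∈ A, ω.length = n) (f : List Bool → ℝ) (hf : ∀ ω, 0 ≤ f ω)
    (hsum : 1 ≤ ∑ ω ∈ A, f ω) :
    ∃ μ : MeasureTheory.ProbabilityMeasure (ℕ → Bool), ∀ w : List Bool, w.length ≤ n →
      (μ : MeasureTheory.Measure (ℕ → Bool)) (cylinder w) ≤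
        ENNReal.ofReal (∑ ω ∈ A with w <+: ω, f ω) := by
  classical
  set Z := ∑ ω ∈ A, f ω
  have hZ : 0 < Z := one_pos.trans_le hsum
  let μ : MeasureTheory.Measure (ℕ → Bool) :=
    ∑ ω ∈ A, ENNReal.ofReal (f ω / Z) • MeasureTheory.Measure.dirac fun i => ω.getD i false
  have hμ : MeasureTheory.IsProbabilityMeasure μ := ⟨by
    simp only [μ, MeasureTheory.Measure.coe_finsetSum, Finset.sum_apply,
      MeasureTheory.Measure.smul_apply, MeasureTheory.measure_univ, smul_eq_mul, mul_one]
    rw [← ENNReal.ofReal_sum_of_nonneg fun ω _ => div_nonneg (hf ω) hZ.le, ← Finset.sum_div,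
      div_self hZ.ne', ENNReal.ofReal_one]⟩
  refine ⟨⟨μ, hμ⟩, fun w hw => ?_⟩
  rw [ENNReal.ofReal_sum_of_nonneg fun ω _ => hf ω, Finset.sum_filter]
  simp only [MeasureTheory.ProbabilityMeasure.coe_mk, μ, MeasureTheory.Measure.coe_finsetSum,
    Finset.sum_apply, MeasureTheory.Measure.smul_apply, smul_eq_mul]
  refine Finset.sum_le_sum fun ω hω => ?_
  rw [MeasureTheory.Measure.dirac_apply' _ (isClopen_cylinder w).isOpen.measurableSet]
  by_cases hmem : (fun i => ω.getD i false) ∈ cylinder w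
  · rw [if_pos (prefix_of_getD_mem_cylinder (hw.trans_eq (hA ω hω).symm) hmem),
      Set.indicator_of_mem hmem, Pi.one_apply, mul_one]
    exact ENNReal.ofReal_le_ofReal (div_le_self (hf ω) hsum)
  · rw [Set.indicator_of_notMem hmem, mul_zero]
    exact zero_le

/-- Any sequence of probability measures on `{0,1}^ℕ` has a cluster point that inherits all
eventual upper bounds on cylinders. -/
lemma exists_probabilityMeasure_of_eventually_cylinder_le
    (μ : ℕ → MeasureTheory.ProbabilityMeasure (ℕ → Bool)) :
    ∃ ξ : MeasureTheory.ProbabilityMeasure (ℕ → Bool), ∀ (w : List Bool) (b : ENNReal),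
      (∀ᶠ n in atTop, (μ n : MeasureTheory.Measure (ℕ → Bool)) (cylinder w) ≤ b) →
        (ξ : MeasureTheory.Measure (ℕ → Bool)) (cylinder w) ≤ b := by
  refine ⟨((hyperfilter ℕ).map μ).lim, fun w b hb => ?_⟩
  have hlim : Tendsto μ (hyperfilter ℕ) (nhds ((hyperfilter ℕ).map μ).lim) :=
    Ultrafilter.le_nhds_lim _
  refine le_of_tendsto
    (MeasureTheory.ProbabilityMeasure.tendsto_measure_of_null_frontier_of_tendsto' hlim ?_)
    (hb.filter_mono Nat.hyperfilter_le_atTop)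
  simp [(isClopen_cylinder w).frontier_eq]

/-- If h > 0, P(h) = 0 and 1 ≤ ∑_{ω ∈ L_n} c_ω^h ≤ K₂ for all n ≥ 1,
then there is a Borel probability measure ξ on {0,1}^ℕ with ξ([ω]) ≤ K₂·c_ω^h for
ω ∈ L and ξ([ω]) = 0 for ω ∉ L. -/
theorem stmt17
    (S : Set ℕ) (hS : S.Infinite)
    (c0 c1 cb0 cb1 : ℝ)
    (hc0 : 0 < c0) (hc0b : c0 ≤ cb0) (hcb0 : cb0 < 1)
    (hc1 : 0 < c1) (hc1b : c1 ≤ cb1) (hcb1 : cb1 < 1)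
    (P Pb : ℝ → ℝ)
    (hP : ∀ t : ℝ, Filter.Tendsto
      (fun n : ℕ => (1 / (n : ℝ)) * Real.log (∑ ω ∈ langWords S n, wt c0 c1 ω ^ t))
      Filter.atTop (nhds (P t)))
    (hPb : ∀ t : ℝ, Filter.Tendsto
      (fun n : ℕ => (1 / (n : ℝ)) * Real.log (∑ ω ∈ langWords S n, wt cb0 cb1 ω ^ t))
      Filter.atTop (nhds (Pb t)))
    (h K₂ : ℝ) (hh : 0 < h) (hPh : P h = 0) (hK₂ : 0 < K₂)
    (hbound : ∀ n : ℕ, 1 ≤ n →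
      1 ≤ ∑ ω ∈ langWords S n, wt c0 c1 ω ^ h ∧
      ∑ ω ∈ langWords S n, wt c0 c1 ω ^ h ≤ K₂) :
    ∃ ξ : MeasureTheory.Measure (ℕ → Bool), MeasureTheory.IsProbabilityMeasure ξ ∧
      ∀ w : List Bool,
        (InLang S w → ξ (cylinder w) ≤ ENNReal.ofReal (K₂ * wt c0 c1 w ^ h)) ∧
        (¬ InLang S w → ξ (cylinder w) = 0) := by
  have hpos : ∀ ω, 0 < wt c0 c1 ω ^ h := fun ω => Real.rpow_pos_of_pos (wt_pos hc0 hc1 ω) h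
  choose μ hμ using fun n : ℕ => exists_probabilityMeasure_cylinder_le (langWords S (n + 1)) (n + 1)
    (fun ω hω => (mem_langWords.1 hω).1) (fun ω => wt c0 c1 ω ^ h) (fun ω => (hpos ω).le)
    (hbound (n + 1) n.succ_pos).1
  obtain ⟨ξ, hξ⟩ := exists_probabilityMeasure_of_eventually_cylinder_le μ
  refine ⟨ξ, inferInstance, fun w => ⟨fun _ => hξ w _ ?_, fun hw => ?_⟩⟩
  · filter_upwards [eventually_ge_atTop w.length] with n hn
    refine (hμ n w (by omega)).trans (ENNReal.ofReal_le_ofReal ?_)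
    refine (sum_langWords_prefix_le hc0 hc1 h (n + 1) w).trans ?_
    rw [mul_comm K₂]
    exact mul_le_mul_of_nonneg_left (hbound _ (by omega)).2 (hpos w).le
  · refine nonpos_iff_eq_zero.1 (hξ w 0 ?_)
    filter_upwards [eventually_ge_atTop w.length] with n hn
    refine (hμ n w (by omega)).trans_eq ?_
    rw [sum_langWords_prefix_eq_zero hw, ENNReal.ofReal_zero]
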